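/- Let a ≥ 1 and d ≥ 1 with ⌈d/a⌉ ≥ 105 and d ≢ −3 (mod a). Then for all n ≥ 1, q_d^{(a)}(n) ≥ Q_d^{(a,−)}(n). Moreover, if d ≡ −3 (mod a), the inequality q_d^{(a)}(n) ≥ Q_d^{(a,−)}(n) holds for all n ≠ d+a+3. -/

import Mathlib

/-- `rho A n` is the number of partitions of `n` all of whose parts lie in `A`. -/
noncomputable def rho (A : Set ℕ) (n : ℕ) : ℕ :=
  Nat.card {p : n.Partition // ∀ x ∈ p.parts, x ∈ A}

/-- `qpart a d n` is the number of partitions of `n` into parts that are all `≥ a`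
and pairwise differ by at least `d` (so, in particular, are distinct when `d ≥ 1`). -/
noncomputable def qpart (a d n : ℕ) : ℕ :=
  Nat.card {p : n.Partition //
    (∀ x ∈ p.parts, a ≤ x) ∧
    (∀ x ∈ p.parts, p.parts.count x ≤ 1) ∧
    (∀ x ∈ p.parts, ∀ y ∈ p.parts, x ≠ y → d ≤ max x y - min x y)}

/-- Positive integers congruent to `±a` modulo `m`, excluding `m - a`. -/
noncomputable def QminusSet (a m : ℕ) : Set ℕ :=
  {x | x % m = a % m ∨ x % m = (m - a) % m} \ {m - a}

/-- `Qminus a d n` counts partitions of `n` into parts `≡ ±a (mod d+3)`,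
excluding the part `d+3-a`. -/
noncomputable def Qminus (a d n : ℕ) : ℕ := rho (QminusSet a (d + 3)) n

/-- `Qmm a d n` counts partitions of `n` into parts `≡ ±a (mod d+3)`,
excluding both the parts `a` and `d+3-a`. -/
noncomputable def Qmm (a d n : ℕ) : ℕ := rho (QminusSet a (d + 3) \ {a}) n

/-- `Tset s d` is the set of naturals congruent to `1` or to `d + 2^j` for some
`1 ≤ j ≤ s - 1` modulo `2d`. -/
def Tset (s d : ℕ) : Set ℕ :=
  {y | y % (2 * d) = 1 % (2 * d) ∨
    ∃ j, 1 ≤ j ∧ j + 1 ≤ s ∧ y % (2 * d) = (d + 2 ^ j) % (2 * d)}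

/-- `T5 d` : naturals congruent to `1, d+2, d+4, d+8` or `d+16` modulo `2d`. -/
def T5 (d : ℕ) : Set ℕ := Tset 5 d

/-- `Sset d N` : naturals congruent to `±1` modulo `d-N+3`, excluding `d-N+2`. -/
def Sset (d N : ℕ) : Set ℕ :=
  {x | x % (d - N + 3) = 1 % (d - N + 3) ∨ x % (d - N + 3) = (d - N + 2) % (d - N + 3)}
    \ {d - N + 2}

/-- `xN d N i` is the `i`-th smallest element of `Sset d N` (1-indexed). -/
noncomputable def xN (d N i : ℕ) : ℕ := Nat.nth (· ∈ Sset d N) (i - 1)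

/-- `yT d i` is the `i`-th smallest element of `T5 d` (1-indexed). -/
noncomputable def yT (d i : ℕ) : ℕ := Nat.nth (· ∈ T5 d) (i - 1)

/-- Removing or keeping the part `b` gives the standard recursion for `qpart`. -/
lemma qpart_add_le (b d n : ℕ) (hb : 1 ≤ b) (hd : 1 ≤ d) (hbn : b ≤ n) :
    qpart (b + 1) d n + qpart (b + d) d (n - b) ≤ qpart b d n := by
  unfold qpart
  rw [← Nat.card_sum]
  refine Nat.card_le_card_of_injective
    (Sum.elim
      (fun p => ⟨p.1, fun x hx => (Nat.le_succ b).trans (p.2.1 x hx), p.2.2.1, p.2.2.2⟩)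
      (fun p => ⟨⟨b ::ₘ p.1.parts, ?_, ?_⟩, ?_, ?_, ?_⟩)) ?_
  · intro i hi
    rcases Multiset.mem_cons.1 hi with rfl | hi
    · exact hb
    · exact p.1.parts_pos hi
  · rw [Multiset.sum_cons, p.1.parts_sum]
    omega
  · intro x hx
    rcases Multiset.mem_cons.1 hx with rfl | hx
    · exact le_rfl
    · have := p.2.1 x hx
      omega
  · intro x hx
    rcases Multiset.mem_cons.1 hx with rfl | hx
    · have hnot : x ∉ p.1.parts := fun h => by
        have := p.2.1 x h
        omega
      simp [Multiset.count_eq_zero_of_notMem hnot]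
    · have hne : x ≠ b := by
        have := p.2.1 x hx
        omega
      simpa [Multiset.count_cons_of_ne hne] using p.2.2.1 x hx
  · intro x hx y hy hxy
    rcases Multiset.mem_cons.1 hx with rfl | hx <;> rcases Multiset.mem_cons.1 hy with rfl | hy
    · exact absurd rfl hxy
    · have := p.2.1 y hy
      omega
    · have := p.2.1 x hx
      omega
    · exact p.2.2.2 x hx y hy hxy
  · refine Function.Injective.sumElim ?_ ?_ ?_
    · intro p p' h
      simpa [Subtype.ext_iff] using h
    · intro p p' h
      simp only [Subtype.mk.injEq, Nat.Partition.mk.injEq, Multiset.cons_inj_right] at h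
      exact Subtype.ext (Nat.Partition.ext h)
    · intro p p' h
      have hp : p.1.parts = b ::ₘ p'.1.parts := congrArg (fun q => q.1.parts) h
      have := p.2.1 b (hp ▸ Multiset.mem_cons_self b _)
      omega

lemma one_le_qpart (b d n : ℕ) (hb : 1 ≤ b) (hbn : b ≤ n) : 1 ≤ qpart b d n := by
  have : Nonempty {p : n.Partition //
      (∀ x ∈ p.parts, b ≤ x) ∧ (∀ x ∈ p.parts, p.parts.count x ≤ 1) ∧
      (∀ x ∈ p.parts, ∀ y ∈ p.parts, x ≠ y → d ≤ max x y - min x y)} := by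
    refine ⟨⟨⟨{n}, ?_, ?_⟩, ?_, ?_, ?_⟩⟩ <;> simp <;> omega
  exact Nat.card_pos

lemma two_le_qpart (b d n : ℕ) (hb : 1 ≤ b) (hd : 1 ≤ d) (hn : 2 * b + d ≤ n) :
    2 ≤ qpart b d n := by
  have h := qpart_add_le b d n hb hd (by omega)
  have h₁ := one_le_qpart (b + 1) d n (by omega) (by omega)
  have h₂ := one_le_qpart (b + d) d (n - b) (by omega) (by omega)
  omega

lemma pow_succ_le_sub_pow_add (M c k : ℕ) (h : c ≤ M) :
    M ^ (k + 1) ≤ (M - c) ^ (k + 1) + (k + 1) * c * M ^ k := by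
  obtain ⟨N, rfl⟩ := Nat.exists_eq_add_of_le h
  rw [Nat.add_sub_cancel_left]
  induction k with
  | zero => simp; omega
  | succ k ih =>
    calc (c + N) ^ (k + 1 + 1) = N * (c + N) ^ (k + 1) + c * (c + N) ^ (k + 1) := by ring
      _ ≤ N * (N ^ (k + 1) + (k + 1) * c * (c + N) ^ k) + c * (c + N) ^ (k + 1) := by
          gcongr
      _ = N ^ (k + 1 + 1) + (k + 1) * c * (N * (c + N) ^ k) + c * (c + N) ^ (k + 1) := by ring
      _ ≤ N ^ (k + 1 + 1) + (k + 1) * c * ((c + N) * (c + N) ^ k) + c * (c + N) ^ (k + 1) := by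
          gcongr
          omega
      _ = _ := by ring

/-- Volume bound: the partitions with `k + 1` parts whose excess over the minimal one is `M`. -/
lemma pow_le_qpart (d : ℕ) (hd : 1 ≤ d) (k : ℕ) : ∀ M b n : ℕ, 1 ≤ b →
    2 * (k + 1) * b + d * (k + 1) * k + 2 * M ≤ 2 * n →
    M ^ k ≤ (k + 1).factorial * k.factorial * qpart b d n := by
  induction k with
  | zero =>
    intro M b n hb h
    simpa using one_le_qpart b d n hb (by omega)
  | succ k ih =>
    intro M
    induction M using Nat.strong_induction_on with
    | _ M ihM =>
      intro b n hb h
      have hbn : b ≤ n := by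
        have : 0 ≤ d * (k + 1 + 1) * (k + 1) := Nat.zero_le _
        nlinarith
      have hrec := qpart_add_le b d n hb hd hbn
      have hfac : (k + 1 + 1).factorial * (k + 1).factorial =
          (k + 1) * (k + 2) * ((k + 1).factorial * k.factorial) := by
        rw [Nat.factorial_succ (k + 1), Nat.factorial_succ k]
        ring
      have h₁ : M ^ k ≤ (k + 1).factorial * k.factorial * qpart (b + d) d (n - b) := by
        refine ih M (b + d) (n - b) (by omega) ?_
        obtain ⟨e, rfl⟩ := Nat.exists_eq_add_of_le hbn
        rw [Nat.add_sub_cancel_left]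
        nlinarith
      have h₂ : (k + 1) * (k + 2) * M ^ k ≤
          (k + 1 + 1).factorial * (k + 1).factorial * qpart (b + d) d (n - b) := by
        rw [hfac, mul_assoc _ _ (qpart _ _ _)]
        exact Nat.mul_le_mul_left _ h₁
      rcases lt_or_ge M (k + 2) with hM | hM
      · calc M ^ (k + 1) = M * M ^ k := by ring
          _ ≤ (k + 1) * (k + 2) * M ^ k := by gcongr; nlinarith
          _ ≤ _ := h₂.trans (Nat.mul_le_mul_left _ (by omega))
      · have h₃ := ihM (M - (k + 2)) (by omega) (b + 1) n (by omega) (by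
          obtain ⟨e, rfl⟩ := Nat.exists_eq_add_of_le hM
          rw [Nat.add_sub_cancel_left]
          nlinarith)
        calc M ^ (k + 1) ≤ (M - (k + 2)) ^ (k + 1) + (k + 1) * (k + 2) * M ^ k :=
              pow_succ_le_sub_pow_add M (k + 2) k hM
          _ ≤ (k + 1 + 1).factorial * (k + 1).factorial *
              (qpart (b + 1) d n + qpart (b + d) d (n - b)) := by
              rw [mul_add (Nat.factorial _ * _)]
              exact add_le_add h₃ h₂
          _ ≤ _ := Nat.mul_le_mul_left _ hrec

lemma pow_le_qpart_of_level (a d n t k M : ℕ) (ha : 1 ≤ a) (hda : 104 * a < d)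
    (ht : t * (2 * d + 6 - a) ≤ 2 * n)
    (hM : 2 * M + 104 * (k + 1) * k + 2 * (k + 1) ≤ 207 * t) :
    M ^ k ≤ (k + 1).factorial * k.factorial * qpart a d n := by
  refine pow_le_qpart d (by omega) k M a n ha ?_
  zify at *
  rw [Nat.cast_sub (by omega)] at ht
  push_cast at ht
  have hk : (0 : ℤ) ≤ 2 * t - (k + 1) * k := by nlinarith
  have h₁ : 0 ≤ ((d : ℤ) - 104 * a) * (2 * t - (k + 1) * k) := mul_nonneg (by linarith) hk
  have h₂ : 0 ≤ ((a : ℤ) - 1) * (207 * t - 104 * (k + 1) * k - 2 * (k + 1)) :=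
    mul_nonneg (by linarith) (by linarith)
  nlinarith

lemma geom_sum_le_inv_one_sub (n : ℕ) {z : ℝ} (hz₀ : 0 ≤ z) (hz₁ : z < 1) :
    ∑ c ∈ Finset.range n, z ^ c ≤ (1 - z)⁻¹ :=
  sum_le_hasSum _ (fun _ _ => by positivity) (hasSum_geometric_of_lt_one hz₀ hz₁)

/-- If every part of a partition of `n` is `a` or lies in `A`, and the total level of the parts in
`A` never exceeds `t`, then such partitions are counted by an Euler-type product. -/
lemma card_partition_le_prod (n a t : ℕ) (ha : 1 ≤ a) (A : Finset ℕ) (haA : a ∉ A) (lvl : ℕ → ℕ)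
    (hlvl : ∀ x ∈ A, 1 ≤ lvl x) (P : n.Partition → Prop)
    (hparts : ∀ p, P p → ∀ x ∈ p.parts, x = a ∨ x ∈ A)
    (hsum : ∀ p, P p → ∑ x ∈ A, p.parts.count x * lvl x ≤ t) (y : ℝ) (hy₀ : 0 < y) (hy₁ : y < 1) :
    (Nat.card {p // P p} : ℝ) ≤ (y ^ t)⁻¹ * ∏ x ∈ A, (1 - y ^ lvl x)⁻¹ := by
  classical
  rw [Nat.card_eq_fintype_card]
  let F : {p // P p} → (A → ℕ) := fun p x => p.1.parts.count x.1
  have hF : Function.Injective F := by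
    intro p p' h
    have hA : ∀ x ∈ A, p.1.parts.count x = p'.1.parts.count x := fun x hx => congrFun h ⟨x, hx⟩
    have hn : ∀ q : {p // P p}, q.1.parts.count a * a + ∑ x ∈ A, q.1.parts.count x * x = n := by
      intro q
      have hsub : q.1.parts.toFinset ⊆ insert a A := by
        intro x hx
        rw [Finset.mem_insert]
        exact hparts q.1 q.2 x (Multiset.mem_toFinset.1 hx)
      have h₁ := Finset.sum_multiset_count_of_subset q.1.parts _ hsub
      rw [q.1.parts_sum, Finset.sum_insert haA] at h₁
      simpa using h₁.symm
    have hca : p.1.parts.count a = p'.1.parts.count a := by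
      have h₁ := hn p
      rw [Finset.sum_congr rfl fun x hx => by rw [hA x hx]] at h₁
      have h₂ := hn p'
      exact Nat.eq_of_mul_eq_mul_right ha (by omega)
    refine Subtype.ext (Nat.Partition.ext (Multiset.ext.2 fun x => ?_))
    by_cases hxa : x = a
    · rw [hxa, hca]
    by_cases hxA : x ∈ A
    · exact hA x hxA
    · have hx : ∀ q : {p // P p}, q.1.parts.count x = 0 := fun q =>
        Multiset.count_eq_zero_of_notMem fun hq => by
          rcases hparts q.1 q.2 x hq with h | h
          exacts [hxa h, hxA h]
      rw [hx, hx]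
  have hcount : ∀ (q : n.Partition) (x : A), q.parts.count x.1 ∈ Finset.range (n + 1) := by
    intro q x
    rw [Finset.mem_range, Nat.lt_succ_iff]
    calc q.parts.count x.1 ≤ q.parts.card := Multiset.count_le_card _ _
      _ = q.parts.card • 1 := by simp
      _ ≤ q.parts.sum := Multiset.card_nsmul_le_sum fun x hx => q.parts_pos hx
      _ = n := q.parts_sum
  have hgeom : ∀ x ∈ A, ∑ c ∈ Finset.range (n + 1), y ^ (c * lvl x) ≤ (1 - y ^ lvl x)⁻¹ := by
    intro x hx
    have hz : y ^ lvl x < 1 := pow_lt_one₀ hy₀.le hy₁ (by have := hlvl x hx; omega)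
    simp_rw [mul_comm _ (lvl x), pow_mul]
    exact geom_sum_le_inv_one_sub _ (by positivity) hz
  have hpos : 0 < y ^ t := by positivity
  rw [inv_mul_eq_div, le_div_iff₀ hpos]
  calc (Fintype.card {p // P p} : ℝ) * y ^ t = ∑ _p : {p // P p}, y ^ t := by simp
    _ ≤ ∑ p : {p // P p}, ∏ x : A, y ^ (F p x * lvl x) := by
        refine Finset.sum_le_sum fun p _ => ?_
        rw [Finset.prod_pow_eq_pow_sum]
        refine pow_le_pow_of_le_one hy₀.le hy₁.le ?_
        rw [Finset.sum_coe_sort A fun x => p.1.parts.count x * lvl x]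
        exact hsum p.1 p.2
    _ = ∑ f ∈ Finset.univ.image F, ∏ x : A, y ^ (f x * lvl x) := by
        rw [Finset.sum_image fun p _ p' _ h => hF h]
    _ ≤ ∑ f ∈ Fintype.piFinset fun _ : A => Finset.range (n + 1), ∏ x : A, y ^ (f x * lvl x) := by
        refine Finset.sum_le_sum_of_subset_of_nonneg ?_ fun f _ _ =>
          Finset.prod_nonneg fun x _ => by positivity
        intro f hf
        obtain ⟨p, -, rfl⟩ := Finset.mem_image.1 hf
        exact Fintype.mem_piFinset.2 fun x => hcount p.1 x
    _ = ∏ x : A, ∑ c ∈ Finset.range (n + 1), y ^ (c * lvl x) :=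
        (Finset.prod_univ_sum (fun _ : A => Finset.range (n + 1))
          fun (x : A) c => y ^ (c * lvl x)).symm
    _ = ∏ x ∈ A, ∑ c ∈ Finset.range (n + 1), y ^ (c * lvl x) :=
        Finset.prod_coe_sort A fun x => ∑ c ∈ Finset.range (n + 1), y ^ (c * lvl x)
    _ ≤ ∏ x ∈ A, (1 - y ^ lvl x)⁻¹ :=
        Finset.prod_le_prod (fun x _ => Finset.sum_nonneg fun c _ => by positivity) hgeom

/-- A part in `QminusSet a m` is `a`, or `j * m + a` with `j ≥ 1`, or `j * m - a` with `j ≥ 2`. -/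
lemma exists_level_of_mem_QminusSet {a m x : ℕ} (ha : 1 ≤ a) (ham : 2 * a < m)
    (hx : x ∈ QminusSet a m) :
    x = a ∨ (∃ j, 1 ≤ j ∧ x = j * m + a) ∨ ∃ j, 2 ≤ j ∧ x = j * m - a := by
  obtain ⟨h, hne⟩ := hx
  have hne : x ≠ m - a := hne
  have hdiv := Nat.div_add_mod' x m
  rcases h with h | h
  · rw [Nat.mod_eq_of_lt (by omega : a < m)] at h
    rcases Nat.eq_zero_or_pos (x / m) with h0 | h0
    · rw [h0] at hdiv
      omega
    · exact Or.inr (Or.inl ⟨x / m, h0, by omega⟩)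
  · rw [Nat.mod_eq_of_lt (by omega : m - a < m)] at h
    rcases Nat.eq_zero_or_pos (x / m) with h0 | h0
    · rw [h0] at hdiv
      omega
    · refine Or.inr (Or.inr ⟨x / m + 1, by omega, ?_⟩)
      rw [add_mul, one_mul]
      omega

lemma Qminus_le_prod (a d n t J : ℕ) (ha : 1 ≤ a) (had : 2 * a ≤ d)
    (ht : 2 * n < (t + 1) * (2 * d + 6 - a)) (htJ : t ≤ J) (y : ℝ) (hy₀ : 0 < y) (hy₁ : y < 1) :
    (Qminus a d n : ℝ) ≤
      (y ^ t)⁻¹ * (∏ j ∈ Finset.Icc 1 J, (1 - y ^ j)⁻¹) * ∏ j ∈ Finset.Icc 2 J, (1 - y ^ j)⁻¹ := by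
  classical
  obtain ⟨m, hm⟩ : ∃ m, m = d + 3 := ⟨_, rfl⟩
  have ham : 2 * a < m := by omega
  have hc : 2 * d + 6 - a = 2 * m - a := by omega
  rw [hc] at ht
  have hlow : ∀ j, 2 ≤ j → j * (2 * m - a) ≤ 2 * (j * m - a) := by
    intro j hj
    obtain ⟨i, rfl⟩ := Nat.exists_eq_add_of_le hj
    obtain ⟨e, rfl⟩ := Nat.exists_eq_add_of_lt ham
    have h₁ : 2 * (2 * a + e + 1) - a = 3 * a + 2 * e + 2 := by omega
    have h₂ : (2 + i) * (2 * a + e + 1) - a = (2 + i) * (a + e + 1) + (1 + i) * a := by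
      apply Nat.sub_eq_of_eq_add
      ring
    rw [h₁, h₂]
    nlinarith [Nat.zero_le (i * a)]
  let lvl : ℕ → ℕ := fun x => (x + a) / m
  have hlvl₁ : ∀ j, lvl (j * m + a) = j := fun j => by
    change (j * m + a + a) / m = j
    rw [add_assoc, mul_comm, Nat.mul_add_div (by omega), Nat.div_eq_of_lt (by omega), add_zero]
  have hlvl₂ : ∀ j, 2 ≤ j → lvl (j * m - a) = j := fun j hj => by
    have : a ≤ j * m := by nlinarith
    change (j * m - a + a) / m = j
    rw [Nat.sub_add_cancel this, Nat.mul_div_cancel _ (by omega)]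
  let B := (Finset.Icc 1 J).image fun j => j * m + a
  let C := (Finset.Icc 2 J).image fun j => j * m - a
  have hB : ∀ x ∈ B, ∃ j, 1 ≤ j ∧ x = j * m + a := fun x hx => by
    obtain ⟨j, hj, rfl⟩ := Finset.mem_image.1 hx
    exact ⟨j, (Finset.mem_Icc.1 hj).1, rfl⟩
  have hC : ∀ x ∈ C, ∃ j, 2 ≤ j ∧ x = j * m - a := fun x hx => by
    obtain ⟨j, hj, rfl⟩ := Finset.mem_image.1 hx
    exact ⟨j, (Finset.mem_Icc.1 hj).1, rfl⟩
  have hlvlBC : ∀ x ∈ B ∪ C, 1 ≤ lvl x ∧ lvl x * (2 * m - a) ≤ 2 * x := by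
    intro x hx
    rcases Finset.mem_union.1 hx with hx | hx
    · obtain ⟨j, hj, rfl⟩ := hB x hx
      rw [hlvl₁]
      refine ⟨hj, ?_⟩
      have := Nat.mul_le_mul_left j (Nat.sub_le (2 * m) a)
      nlinarith
    · obtain ⟨j, hj, rfl⟩ := hC x hx
      rw [hlvl₂ j hj]
      exact ⟨by omega, hlow j hj⟩
  have hBC : Disjoint B C := by
    rw [Finset.disjoint_left]
    intro x hxB hxC
    obtain ⟨j, hj, rfl⟩ := hB x hxB
    obtain ⟨i, hi, h⟩ := hC _ hxC
    have hij : j = i := by rw [← hlvl₁ j, h, hlvl₂ i hi]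
    subst hij
    omega
  have haBC : a ∉ B ∪ C := by
    intro h
    have := (hlvlBC a h).1
    have h0 : lvl a = 0 := Nat.div_eq_of_lt (by omega)
    omega
  have hJ : ∀ x j, x ≤ n → j * (2 * m - a) ≤ 2 * x → j ≤ J := by
    intro x j hx hj
    have : j < t + 1 := lt_of_mul_lt_mul_right (by omega) (Nat.zero_le (2 * m - a))
    omega
  have hprod := card_partition_le_prod n a t ha (B ∪ C) haBC lvl (fun x hx => (hlvlBC x hx).1)
    (fun p => ∀ x ∈ p.parts, x ∈ QminusSet a m) ?_ ?_ y hy₀ hy₁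
  · have hprodB : ∏ x ∈ B, (1 - y ^ lvl x)⁻¹ = ∏ j ∈ Finset.Icc 1 J, (1 - y ^ j)⁻¹ := by
      rw [Finset.prod_image]
      · exact Finset.prod_congr rfl fun j _ => by rw [hlvl₁ j]
      · intro i _ j _ h
        rw [← hlvl₁ i, ← hlvl₁ j]
        exact congrArg lvl h
    have hprodC : ∏ x ∈ C, (1 - y ^ lvl x)⁻¹ = ∏ j ∈ Finset.Icc 2 J, (1 - y ^ j)⁻¹ := by
      rw [Finset.prod_image]
      · exact Finset.prod_congr rfl fun j hj => by rw [hlvl₂ j (Finset.mem_Icc.1 hj).1]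
      · intro i hi j hj h
        rw [← hlvl₂ i (Finset.mem_Icc.1 hi).1, ← hlvl₂ j (Finset.mem_Icc.1 hj).1]
        exact congrArg lvl h
    rw [Finset.prod_union hBC, ← mul_assoc, hprodB, hprodC] at hprod
    rw [Qminus, rho, ← hm]
    exact hprod
  · intro p hp x hx
    have hxn : x ≤ n := p.parts_sum ▸ Multiset.le_sum_of_mem hx
    rcases exists_level_of_mem_QminusSet ha ham (hp x hx) with h | ⟨j, hj, rfl⟩ | ⟨j, hj, rfl⟩
    · exact Or.inl h
    · refine Or.inr (Finset.mem_union_left _ (Finset.mem_image_of_mem _ (Finset.mem_Icc.2 ⟨hj, ?_⟩)))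
      refine hJ _ j hxn ?_
      have := Nat.mul_le_mul_left j (Nat.sub_le (2 * m) a)
      nlinarith
    · exact Or.inr (Finset.mem_union_right _ (Finset.mem_image_of_mem _
        (Finset.mem_Icc.2 ⟨hj, hJ _ j hxn (hlow j hj)⟩)))
  · intro p _
    have h₁ : ∑ x ∈ B ∪ C, p.parts.count x * x ≤ n := by
      calc ∑ x ∈ B ∪ C, p.parts.count x * x
          ≤ ∑ x ∈ (B ∪ C) ∪ p.parts.toFinset, p.parts.count x * x :=
            Finset.sum_le_sum_of_subset Finset.subset_union_left
        _ = p.parts.sum := by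
            rw [Finset.sum_multiset_count_of_subset p.parts (B ∪ C ∪ p.parts.toFinset)
              Finset.subset_union_right]
            simp only [smul_eq_mul]
        _ = n := p.parts_sum
    have h₂ : (∑ x ∈ B ∪ C, p.parts.count x * lvl x) * (2 * m - a) ≤
        2 * ∑ x ∈ B ∪ C, p.parts.count x * x := by
      rw [Finset.sum_mul, Finset.mul_sum]
      refine Finset.sum_le_sum fun x hx => ?_
      have := Nat.mul_le_mul_left (p.parts.count x) (hlvlBC x hx).2
      nlinarith
    have : ∑ x ∈ B ∪ C, p.parts.count x * lvl x < t + 1 :=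
      lt_of_mul_lt_mul_right (by omega) (Nat.zero_le (2 * m - a))
    omega

/-- Elementary bound for the partition generating function. -/
lemma prod_inv_one_sub_pow_le_exp (J : ℕ) (y : ℝ) (hy₀ : 0 < y) (hy₁ : y < 1) :
    ∏ j ∈ Finset.Icc 1 J, (1 - y ^ j)⁻¹ ≤ Real.exp (5 / 3 * (y / (1 - y))) := by
  have hpow : ∀ j ∈ Finset.Icc 1 J, y ^ j < 1 := fun j hj =>
    pow_lt_one₀ hy₀.le hy₁ (by have := (Finset.mem_Icc.1 hj).1; omega)
  have hpos : ∀ j ∈ Finset.Icc 1 J, 0 < (1 - y ^ j)⁻¹ := fun j hj =>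
    inv_pos.2 (sub_pos.2 (hpow j hj))
  rw [← Real.log_le_iff_le_exp (Finset.prod_pos hpos),
    Real.log_prod fun j hj => (hpos j hj).ne']
  have h₁ : HasSum (fun r : ℕ => ∑ j ∈ Finset.Icc 1 J, (y ^ j) ^ (r + 1) / (r + 1))
      (∑ j ∈ Finset.Icc 1 J, Real.log (1 - y ^ j)⁻¹) := by
    refine hasSum_sum fun j hj => ?_
    rw [Real.log_inv]
    refine Real.hasSum_pow_div_log_of_abs_lt_one ?_
    rw [abs_of_pos (by positivity)]
    exact hpow j hj
  have h₂ : HasSum (fun r : ℕ => 1 / ((r + 1 : ℕ) : ℝ) ^ 2) (Real.pi ^ 2 / 6) := by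
    have h := (hasSum_nat_add_iff' (f := fun r : ℕ => 1 / (r : ℝ) ^ 2) 1).2 hasSum_zeta_two
    simpa using h
  have h₃ : ∀ r : ℕ, ∑ j ∈ Finset.Icc 1 J, (y ^ j) ^ (r + 1) / (r + 1) ≤
      1 / ((r + 1 : ℕ) : ℝ) ^ 2 * (y / (1 - y)) := by
    intro r
    have hz : y ^ (r + 1) < 1 := pow_lt_one₀ hy₀.le hy₁ (by omega)
    have hgeom : ∑ j ∈ Finset.Icc 1 J, (y ^ j) ^ (r + 1) ≤ y ^ (r + 1) * (1 - y ^ (r + 1))⁻¹ := by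
      have : ∑ j ∈ Finset.Icc 1 J, (y ^ j) ^ (r + 1) =
          y ^ (r + 1) * ∑ j ∈ Finset.range J, (y ^ (r + 1)) ^ j := by
        clear hpow hpos h₁
        induction J with
        | zero => simp
        | succ J ih =>
          rw [Finset.sum_Icc_succ_top (by omega), Finset.sum_range_succ, ih]
          ring
      rw [this]
      gcongr
      exact geom_sum_le_inv_one_sub _ (by positivity) hz
    have hmean : (r + 1) * y ^ r * (1 - y) ≤ 1 - y ^ (r + 1) := by
      rw [← mul_neg_geom_sum y (r + 1), mul_comm]
      refine mul_le_mul_of_nonneg_left ?_ (by linarith)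
      have : ∀ i ∈ Finset.range (r + 1), y ^ r ≤ y ^ i := fun i hi =>
        pow_le_pow_of_le_one hy₀.le hy₁.le (by have := Finset.mem_range.1 hi; omega)
      simpa using Finset.card_nsmul_le_sum _ _ _ this
    rw [← Finset.sum_div]
    have hy : 0 < 1 - y := by linarith
    have hz' : 0 < 1 - y ^ (r + 1) := by linarith
    have hbase : y ^ (r + 1) * (1 - y ^ (r + 1))⁻¹ ≤ y / ((r + 1) * (1 - y)) := by
      rw [← div_eq_mul_inv, div_le_div_iff₀ hz' (by positivity)]
      calc y ^ (r + 1) * ((r + 1) * (1 - y)) = y * ((r + 1) * y ^ r * (1 - y)) := by ring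
        _ ≤ _ := by gcongr
    calc (∑ j ∈ Finset.Icc 1 J, (y ^ j) ^ (r + 1)) / (r + 1)
        ≤ y / ((r + 1) * (1 - y)) / (r + 1) := by
          gcongr
          exact hgeom.trans hbase
      _ = _ := by
          push_cast
          field_simp
  have h₄ := hasSum_le h₃ h₁ (h₂.mul_right _)
  refine h₄.trans ?_
  have : Real.pi ^ 2 / 6 ≤ 5 / 3 := by
    have := Real.pi_lt_d2
    nlinarith [Real.pi_pos]
  have hy : 0 < 1 - y := by linarith
  gcongr

lemma prod_Icc_one_eq (J : ℕ) (hJ : 1 ≤ J) (f : ℕ → ℝ) :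
    ∏ j ∈ Finset.Icc 1 J, f j = f 1 * ∏ j ∈ Finset.Icc 2 J, f j := by
  rw [← Finset.insert_Icc_add_one_left_eq_Icc hJ, Finset.prod_insert (by simp),
    one_add_one_eq_two]

lemma Qminus_le_six_mul_two_pow (a d n t : ℕ) (ha : 1 ≤ a) (had : 2 * a ≤ d) (ht16 : t ≤ 16)
    (ht : 2 * n < (t + 1) * (2 * d + 6 - a)) : Qminus a d n ≤ 6 * 2 ^ t := by
  have h := Qminus_le_prod a d n t 16 ha had ht ht16 (1 / 2) (by norm_num) (by norm_num)
  have hnum : (∏ j ∈ Finset.Icc 1 16, (1 - (1 / 2 : ℝ) ^ j)⁻¹) *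
      ∏ j ∈ Finset.Icc 2 16, (1 - (1 / 2 : ℝ) ^ j)⁻¹ ≤ 6 := by
    rw [prod_Icc_one_eq 16 (by norm_num)]
    simp only [Finset.prod_Icc_succ_top, Nat.reduceLeDiff, Nat.reduceAdd, Finset.Icc_self,
      Finset.prod_singleton]
    norm_num [Finset.prod_Icc_succ_top]
  rw [mul_assoc] at h
  have hR : (Qminus a d n : ℝ) ≤ 6 * 2 ^ t := by
    calc (Qminus a d n : ℝ) ≤ ((1 / 2 : ℝ) ^ t)⁻¹ * 6 := h.trans (by gcongr)
      _ = 6 * 2 ^ t := by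
        rw [one_div, inv_pow, inv_inv, mul_comm]
  exact_mod_cast hR

lemma exp_eleven_thirds_le : Real.exp (11 / 3) ≤ 40 := by
  have h : Real.exp (11 / 3) ^ 3 ≤ 40 ^ 3 := by
    rw [← Real.exp_nat_mul]
    calc Real.exp ((3 : ℕ) * (11 / 3)) = Real.exp 1 ^ 11 := by
          rw [← Real.exp_nat_mul]
          norm_num
      _ ≤ 2.7182818286 ^ 11 := by
          gcongr
          exact Real.exp_one_lt_d9.le
      _ ≤ 40 ^ 3 := by norm_num
  exact le_of_pow_le_pow_left₀ (by norm_num) (by norm_num) h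

lemma Qminus_le_forty_pow (a d n t K : ℕ) (ha : 1 ≤ a) (had : 2 * a ≤ d) (hK : 5 ≤ K)
    (htK : t ≤ K ^ 2) (ht : 2 * n < (t + 1) * (2 * d + 6 - a)) :
    7 * Qminus a d n ≤ 2 * 40 ^ K := by
  have hKR : (5 : ℝ) ≤ K := by exact_mod_cast hK
  have hK0 : (0 : ℝ) < K := by linarith
  obtain ⟨y, hy⟩ : ∃ y : ℝ, y = K / (K + 2) := ⟨_, rfl⟩
  have hy₀ : 0 < y := by rw [hy]; positivity
  have h1y : 1 - y = 2 / (K + 2) := by rw [hy]; field_simp; ring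
  have hy₁ : y < 1 := by
    have : 0 < 1 - y := by rw [h1y]; positivity
    linarith
  have hodds : y / (1 - y) = K / 2 := by rw [h1y, hy]; field_simp
  have hK2 : 1 ≤ K ^ 2 := Nat.one_le_pow _ _ (by omega)
  have h := Qminus_le_prod a d n t (K ^ 2) ha had ht htK y hy₀ hy₁
  have hE := prod_inv_one_sub_pow_le_exp (K ^ 2) y hy₀ hy₁
  rw [hodds] at hE
  have hpos : ∀ i, 0 ≤ ∏ j ∈ Finset.Icc i (K ^ 2), (1 - y ^ j)⁻¹ := fun i =>
    Finset.prod_nonneg fun j _ => inv_nonneg.2 (sub_nonneg.2 (pow_le_one₀ hy₀.le hy₁.le))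
  have hC : ∏ j ∈ Finset.Icc 2 (K ^ 2), (1 - y ^ j)⁻¹ ≤
      2 / 7 * Real.exp (5 / 3 * (K / 2)) := by
    have h2 : ∏ j ∈ Finset.Icc 2 (K ^ 2), (1 - y ^ j)⁻¹ =
        (1 - y) * ∏ j ∈ Finset.Icc 1 (K ^ 2), (1 - y ^ j)⁻¹ := by
      rw [prod_Icc_one_eq _ hK2, pow_one, mul_inv_cancel_left₀ (by linarith)]
    rw [h2]
    refine mul_le_mul ?_ hE (hpos 1) (by norm_num)
    rw [h1y, div_le_div_iff₀ (by positivity) (by norm_num)]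
    linarith
  have hpow : (y ^ t)⁻¹ ≤ Real.exp (2 * K) := by
    calc (y ^ t)⁻¹ ≤ (y ^ (K ^ 2))⁻¹ := by
          gcongr ?_⁻¹
          exact pow_le_pow_of_le_one hy₀.le hy₁.le htK
      _ = (2 / (K : ℝ) + 1) ^ (K ^ 2) := by
          rw [← inv_pow, hy, inv_div]
          congr 1
          field_simp
          ring
      _ ≤ Real.exp (2 / K) ^ (K ^ 2) := by
          gcongr
          exact Real.add_one_le_exp _
      _ = Real.exp (2 * K) := by
          rw [← Real.exp_nat_mul]
          congr 1
          push_cast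
          field_simp
  have hR : (7 : ℝ) * Qminus a d n ≤ 2 * 40 ^ K := by
    calc (7 : ℝ) * Qminus a d n
        ≤ 7 * (Real.exp (2 * K) * Real.exp (5 / 3 * (K / 2)) *
            (2 / 7 * Real.exp (5 / 3 * (K / 2)))) := by
          refine mul_le_mul_of_nonneg_left (h.trans ?_) (by norm_num)
          have := hpos 1
          have := hpos 2
          gcongr
      _ = 2 * (Real.exp (2 * K) * Real.exp (5 / 3 * (K / 2)) * Real.exp (5 / 3 * (K / 2))) := by
          ring
      _ = 2 * Real.exp (11 / 3) ^ K := by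
          rw [← Real.exp_add, ← Real.exp_add, ← Real.exp_nat_mul]
          ring_nf
      _ ≤ 2 * 40 ^ K := by
          gcongr
          exact exp_eleven_thirds_le
  exact_mod_cast hR

lemma pow_succ_add_mul_le_add_pow (M D k : ℕ) :
    M ^ (k + 1) + (k + 1) * M ^ k * D ≤ (M + D) ^ (k + 1) := by
  induction k with
  | zero => simp
  | succ k ih =>
    calc M ^ (k + 1 + 1) + (k + 1 + 1) * M ^ (k + 1) * D
        ≤ M ^ (k + 1 + 1) + (k + 1 + 1) * M ^ (k + 1) * D + (k + 1) * M ^ k * D ^ 2 :=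
          Nat.le_add_right _ _
      _ = (M ^ (k + 1) + (k + 1) * M ^ k * D) * (M + D) := by ring
      _ ≤ (M + D) ^ (k + 1) * (M + D) := Nat.mul_le_mul_right _ ih
      _ = (M + D) ^ (k + 1 + 1) := by ring

lemma forty_pow_mul_factorial_le (k : ℕ) :
    2 * 40 ^ (k + 5) * ((k + 5).factorial * (k + 4).factorial) ≤
      7 * (51 * k ^ 2 + 359 * k + 714) ^ (k + 4) := by
  induction k with
  | zero => norm_num [Nat.factorial]
  | succ k ih =>
    obtain ⟨M, hM⟩ : ∃ M, M = 51 * k ^ 2 + 359 * k + 714 := ⟨_, rfl⟩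
    have hM' : 51 * (k + 1) ^ 2 + 359 * (k + 1) + 714 = M + (102 * k + 410) := by
      rw [hM]
      ring
    rw [← hM] at ih
    rw [hM']
    obtain ⟨D, hD⟩ : ∃ D, D = 102 * k + 410 := ⟨_, rfl⟩
    rw [← hD]
    have hbern : 2 * M ^ (k + 4) ≤ (M + D) ^ (k + 4) := by
      have h₁ : M ≤ (k + 4) * D := by rw [hM, hD]; nlinarith
      have h₂ : M ^ (k + 4) + (k + 4) * M ^ (k + 3) * D ≤ (M + D) ^ (k + 4) :=
        pow_succ_add_mul_le_add_pow M D (k + 3)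
      have h₃ : M ^ (k + 4) ≤ (k + 4) * M ^ (k + 3) * D := by
        calc M ^ (k + 4) = M * M ^ (k + 3) := by ring
          _ ≤ (k + 4) * D * M ^ (k + 3) := by gcongr
          _ = _ := by ring
      linarith
    have hstep : 40 * ((k + 6) * (k + 5)) ≤ 2 * (M + D) := by
      rw [hM, hD]
      nlinarith
    calc 2 * 40 ^ (k + 1 + 5) * ((k + 1 + 5).factorial * (k + 1 + 4).factorial)
        = 40 * ((k + 6) * (k + 5)) *
            (2 * 40 ^ (k + 5) * ((k + 5).factorial * (k + 4).factorial)) := by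
          rw [show k + 1 + 5 = (k + 5) + 1 by ring, show k + 1 + 4 = (k + 4) + 1 by ring,
            Nat.factorial_succ (k + 5), Nat.factorial_succ (k + 4)]
          ring
      _ ≤ 2 * (M + D) * (7 * M ^ (k + 4)) := Nat.mul_le_mul hstep ih
      _ = 7 * (M + D) * (2 * M ^ (k + 4)) := by ring
      _ ≤ 7 * (M + D) * (M + D) ^ (k + 4) := Nat.mul_le_mul_left _ hbern
      _ = 7 * (M + D) ^ (k + 1 + 4) := by ring

lemma Qminus_le_qpart_of_two_le_level (a d n t : ℕ) (ha : 1 ≤ a) (hda : 104 * a < d) (ht2 : 2 ≤ t)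
    (htl : t * (2 * d + 6 - a) ≤ 2 * n) (htu : 2 * n < (t + 1) * (2 * d + 6 - a)) :
    Qminus a d n ≤ qpart a d n := by
  have had : 2 * a ≤ d := by omega
  rcases le_or_gt t 16 with ht16 | ht16
  · have hQ : ∀ s, t ≤ s → Qminus a d n ≤ 6 * 2 ^ s := fun s hs =>
      (Qminus_le_six_mul_two_pow a d n t ha had ht16 htu).trans
        (Nat.mul_le_mul_left _ (Nat.pow_le_pow_right (by norm_num) hs))
    rcases le_or_gt t 3 with h3 | h3
    · have h := pow_le_qpart_of_level a d n t 1 101 ha hda htl (by omega)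
      have := hQ 3 h3
      norm_num [Nat.factorial] at h this
      omega
    rcases le_or_gt t 7 with h7 | h7
    · have h := pow_le_qpart_of_level a d n t 2 99 ha hda htl (by omega)
      have := hQ 7 h7
      norm_num [Nat.factorial] at h this
      omega
    rcases le_or_gt t 11 with h11 | h11
    · have h := pow_le_qpart_of_level a d n t 2 513 ha hda htl (by omega)
      have := hQ 11 h11
      norm_num [Nat.factorial] at h this
      omega
    · have h := pow_le_qpart_of_level a d n t 3 614 ha hda htl (by omega)
      have := hQ 16 ht16
      norm_num [Nat.factorial] at h this
      omega
  · obtain ⟨s, hs⟩ : ∃ s, s = Nat.sqrt (t - 1) := ⟨_, rfl⟩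
    have hs₁ : s ^ 2 + 1 ≤ t := by
      have := Nat.sqrt_le' (t - 1)
      rw [← hs] at this
      omega
    have hs₂ : t ≤ (s + 1) ^ 2 := by
      have := Nat.lt_succ_sqrt' (t - 1)
      rw [← hs, Nat.succ_eq_add_one] at this
      omega
    have hs4 : 4 ≤ s := by nlinarith
    obtain ⟨k, rfl⟩ := Nat.exists_eq_add_of_le' hs4
    have hup := Qminus_le_forty_pow a d n t (k + 5) ha had (by omega) hs₂ htu
    have hlow := pow_le_qpart_of_level a d n t (k + 4) (51 * k ^ 2 + 359 * k + 714) ha hda htl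
      (by nlinarith)
    have hnum := forty_pow_mul_factorial_le k
    have hfac : 0 < (k + 5).factorial * (k + 4).factorial := by positivity
    refine Nat.le_of_mul_le_mul_left ?_ (Nat.mul_pos (by norm_num : 0 < 7) hfac)
    calc 7 * ((k + 5).factorial * (k + 4).factorial) * Qminus a d n
        = 7 * Qminus a d n * ((k + 5).factorial * (k + 4).factorial) := by ring
      _ ≤ 2 * 40 ^ (k + 5) * ((k + 5).factorial * (k + 4).factorial) :=
          Nat.mul_le_mul_right _ hup
      _ ≤ 7 * (51 * k ^ 2 + 359 * k + 714) ^ (k + 4) := hnum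
      _ ≤ 7 * ((k + 5).factorial * (k + 4).factorial * qpart a d n) :=
          Nat.mul_le_mul_left _ hlow
      _ = _ := by ring

/-- Below `2 * m - a`, the only parts available are `a` and at most one `m + a`. -/
lemma parts_eq_of_lt {a m n : ℕ} (ha : 1 ≤ a) (ham : 2 * a < m) (hn : n < 2 * m - a)
    (p : n.Partition) (hp : ∀ x ∈ p.parts, x ∈ QminusSet a m) :
    (∃ e, p.parts = Multiset.replicate e a ∧ e * a = n) ∨
      ∃ e, p.parts = (m + a) ::ₘ Multiset.replicate e a ∧ m + a + e * a = n := by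
  have hpart : ∀ x ∈ p.parts, x = a ∨ x = m + a := by
    intro x hx
    have hxn : x ≤ n := p.parts_sum ▸ Multiset.le_sum_of_mem hx
    rcases exists_level_of_mem_QminusSet ha ham (hp x hx) with h | ⟨j, hj, rfl⟩ | ⟨j, hj, rfl⟩
    · exact Or.inl h
    · rcases hj.eq_or_lt with rfl | hj
      · exact Or.inr (by omega)
      · have : 2 * m ≤ j * m := Nat.mul_le_mul_right m hj
        omega
    · have : 2 * m ≤ j * m := Nat.mul_le_mul_right m hj
      omega
  by_cases hmem : m + a ∈ p.parts
  · right
    obtain ⟨s, hs⟩ := Multiset.exists_cons_of_mem hmem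
    have hsum : m + a + s.sum = n := by rw [← Multiset.sum_cons, ← hs, p.parts_sum]
    have hsa : s = Multiset.replicate s.card a := by
      refine Multiset.eq_replicate_card.2 fun x hx => ?_
      rcases hpart x (hs ▸ Multiset.mem_cons_of_mem hx) with h | h
      · exact h
      · have := Multiset.le_sum_of_mem hx
        omega
    refine ⟨s.card, by rw [hs, ← hsa], ?_⟩
    rw [hsa] at hsum
    simpa using hsum
  · left
    have hpa : p.parts = Multiset.replicate p.parts.card a :=
      Multiset.eq_replicate_card.2 fun x hx =>
        (hpart x hx).resolve_right fun h => hmem (h ▸ hx)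
    refine ⟨p.parts.card, hpa, ?_⟩
    have hsum := p.parts_sum
    rw [hpa] at hsum
    simpa using hsum

lemma Qminus_le_qpart_of_lt (a d n : ℕ) (ha : 1 ≤ a) (had : 2 * a ≤ d) (hn₁ : 1 ≤ n)
    (hn : n < 2 * (d + 3) - a) (hexc : a ∣ d + 3 → n ≠ d + a + 3) :
    Qminus a d n ≤ qpart a d n := by
  classical
  have hstruct := fun p : {p : n.Partition // ∀ x ∈ p.parts, x ∈ QminusSet a (d + 3)} =>
    parts_eq_of_lt ha (by omega) hn p.1 p.2
  have hle2 : Qminus a d n ≤ 2 := by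
    have hinj : Function.Injective
        fun p : {p : n.Partition // ∀ x ∈ p.parts, x ∈ QminusSet a (d + 3)} =>
          decide (d + 3 + a ∈ p.1.parts) := by
      intro p p' h
      have h : (d + 3 + a ∈ p.1.parts) ↔ (d + 3 + a ∈ p'.1.parts) := by simpa using h
      have hnot : ∀ e, d + 3 + a ∉ Multiset.replicate e a := fun e he => by
        have := Multiset.eq_of_mem_replicate he
        omega
      refine Subtype.ext (Nat.Partition.ext ?_)
      rcases hstruct p with ⟨e, he, hs⟩ | ⟨e, he, hs⟩ <;>
        rcases hstruct p' with ⟨e', he', hs'⟩ | ⟨e', he', hs'⟩ <;>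
        rw [he, he'] at h ⊢
      · rw [Nat.eq_of_mul_eq_mul_right ha (hs.trans hs'.symm)]
      · exact absurd (h.2 (Multiset.mem_cons_self _ _)) (hnot e)
      · exact absurd (h.1 (Multiset.mem_cons_self _ _)) (hnot e')
      · rw [Nat.eq_of_mul_eq_mul_right ha (show e * a = e' * a by omega)]
    simpa [Qminus, rho] using Nat.card_le_card_of_injective _ hinj
  rcases Nat.eq_zero_or_pos (Qminus a d n) with h0 | hpos
  · omega
  have hna : a ≤ n := by
    obtain ⟨p⟩ := (Nat.card_pos_iff.1 hpos).1
    rcases hstruct p with ⟨e, -, hs⟩ | ⟨e, -, hs⟩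
    · have : e ≠ 0 := by
        rintro rfl
        omega
      exact hs ▸ Nat.le_mul_of_pos_left a (Nat.pos_of_ne_zero this)
    · omega
  have hq := one_le_qpart a d n ha hna
  rcases le_or_gt (Qminus a d n) 1 with h1 | h1
  · omega
  suffices h : 2 * a + d ≤ n from hle2.trans (two_le_qpart a d n ha (by omega) h)
  obtain ⟨p, p', hne⟩ := (Finite.one_lt_card_iff_nontrivial.1 h1).exists_pair_ne
  have key : ∀ e e', e * a = n → d + 3 + a + e' * a = n → 2 * a + d ≤ n := by
    intro e e' he he'
    have hdvd : a ∣ d + 3 := by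
      rw [show d + 3 = (d + 3 + a + e' * a) - (e' + 1) * a by rw [add_mul]; omega, he', ← he]
      exact Nat.dvd_sub (Dvd.intro_left _ rfl) (Dvd.intro_left _ rfl)
    have : e' ≠ 0 := by
      rintro rfl
      exact hexc hdvd (by omega)
    have := Nat.le_mul_of_pos_left a (Nat.pos_of_ne_zero this)
    omega
  rcases hstruct p with ⟨e, he, hs⟩ | ⟨e, he, hs⟩ <;>
    rcases hstruct p' with ⟨e', he', hs'⟩ | ⟨e', he', hs'⟩
  · refine absurd (Subtype.ext (Nat.Partition.ext ?_)) hne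
    rw [he, he', Nat.eq_of_mul_eq_mul_right ha (hs.trans hs'.symm)]
  · exact key e e' hs hs'
  · exact key e' e hs' hs
  · refine absurd (Subtype.ext (Nat.Partition.ext ?_)) hne
    rw [he, he', Nat.eq_of_mul_eq_mul_right ha (show e * a = e' * a by omega)]

theorem stmt16 (a d : ℕ) (ha : 1 ≤ a) (hd : 1 ≤ d)
    (hda : 105 ≤ (d + a - 1) / a) :
    (¬ a ∣ (d + 3) → ∀ n, 1 ≤ n → Qminus a d n ≤ qpart a d n) ∧
    (a ∣ (d + 3) → ∀ n, 1 ≤ n → n ≠ d + a + 3 → Qminus a d n ≤ qpart a d n) := by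
  have hda' : 104 * a < d := by
    have := (Nat.le_div_iff_mul_le (by omega : 0 < a)).1 hda
    omega
  have key : ∀ n, 1 ≤ n → (a ∣ d + 3 → n ≠ d + a + 3) → Qminus a d n ≤ qpart a d n := by
    intro n hn hexc
    have hc : 0 < 2 * d + 6 - a := by omega
    rcases le_or_gt 2 (2 * n / (2 * d + 6 - a)) with ht | ht
    · exact Qminus_le_qpart_of_two_le_level a d n _ ha hda' ht (Nat.div_mul_le_self _ _)
        ((Nat.div_lt_iff_lt_mul hc).1 (Nat.lt_succ_self _))
    · refine Qminus_le_qpart_of_lt a d n ha (by omega) hn ?_ hexc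
      have := (Nat.div_lt_iff_lt_mul hc).1 ht
      omega
  exact ⟨fun h n hn => key n hn fun h' => absurd h' h, fun _ n hn hne => key n hn fun _ => hne⟩
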